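/- arXiv:0810.4767 — 3 statements merged into one kernel-verified Lean document; each statement's English description precedes it below -/
import Mathlib

section
/- Let λ_1, …, λ_n be distinct nonzero complex numbers such that conj(λ_j) ≠ ±i·λ_l for all j, l ∈ {1,…,n}. Let Γ = diag(γ_1,…,γ_n) be any complex diagonal matrix, ε ∈ {1,−1}, V the n×n matrix with entries V_{jk} = λ_j^{n−k}, and E = diag((iε)^{n−1}, …, (iε), 1). Let T be the 2n×2n block matrix (V, ΓVE; −conj(Γ)·conj(V)·conj(E), conj(V)). Then there exists a constant C > 0 depending only on λ_1,…,λ_n (and not on Γ) such that det T > C. -/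
open Matrix Complex

/-- The Vandermonde-type matrix with entries `V j k = (λ j)^(n-1-k)`. -/
noncomputable def Vmat {n : ℕ} (lam : Fin n → ℂ) : Matrix (Fin n) (Fin n) ℂ :=
  Matrix.of fun j k => lam j ^ (n - 1 - (k : ℕ))

/-- The diagonal matrix `E = diag((iε)^(n-1), …, (iε), 1)`. -/
noncomputable def Emat (n : ℕ) (ε : ℂ) : Matrix (Fin n) (Fin n) ℂ :=
  Matrix.diagonal fun k => (Complex.I * ε) ^ (n - 1 - (k : ℕ))

open Polynomial in
/-- polynomial with coefficients from a vector -/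
noncomputable def polOf {n : ℕ} (z : Fin n → ℂ) : Polynomial ℂ :=
  ∑ k : Fin n, C (z k) * X ^ (n - 1 - (k : ℕ))

lemma polOf_eval {n : ℕ} (z : Fin n → ℂ) (x : ℂ) :
    (polOf z).eval x = ∑ k : Fin n, z k * x ^ (n - 1 - (k : ℕ)) := by
  simp [polOf, Polynomial.eval_finsetSum]

lemma polOf_natDegree {n : ℕ} (z : Fin n → ℂ) : (polOf z).natDegree ≤ n - 1 := by
  unfold polOf
  refine Polynomial.natDegree_sum_le_of_forall_le _ _ fun k _ => ?_
  exact (Polynomial.natDegree_C_mul_X_pow_le _ _).trans (by omega)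

lemma polOf_eq_zero {n : ℕ} (z : Fin n → ℂ) (h : polOf z = 0) : z = 0 := by
  funext j
  have h1 : (polOf z).coeff (n - 1 - (j : ℕ)) = z j := by
    unfold polOf
    rw [Polynomial.finsetSum_coeff, Finset.sum_eq_single j]
    · simp
    · intro k _ hk
      rw [Polynomial.coeff_C_mul_X_pow, if_neg]
      intro h2
      apply hk
      ext
      have := k.2
      have := j.2
      omega
    · simp
  rw [← h1, h]
  simp

/-- Homogenized matrix -/
noncomputable def TT {n : ℕ} (lam : Fin n → ℂ) (μ : ℂ) (a : Fin n → ℂ × ℂ) :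
    Matrix (Fin n ⊕ Fin n) (Fin n ⊕ Fin n) ℂ :=
  Matrix.fromBlocks
    (Matrix.of fun j (k : Fin n) => (a j).1 * lam j ^ (n - 1 - (k : ℕ)))
    (Matrix.of fun j (k : Fin n) => (a j).2 * (μ * lam j) ^ (n - 1 - (k : ℕ)))
    (-((Matrix.of fun j (k : Fin n) => (a j).2 * (μ * lam j) ^ (n - 1 - (k : ℕ))).map (starRingEnd ℂ)))
    ((Matrix.of fun j (k : Fin n) => (a j).1 * lam j ^ (n - 1 - (k : ℕ))).map (starRingEnd ℂ))

lemma block_det_im {n : ℕ} (A B : Matrix (Fin n) (Fin n) ℂ) :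
    (Matrix.fromBlocks A B (-(B.map (starRingEnd ℂ))) (A.map (starRingEnd ℂ))).det.im = 0 := by
  rw [← Complex.conj_eq_iff_im]
  rw [RingHom.map_det]
  have h1 : (starRingEnd ℂ).mapMatrix
      (Matrix.fromBlocks A B (-(B.map (starRingEnd ℂ))) (A.map (starRingEnd ℂ)))
      = Matrix.fromBlocks 0 1 (-1) 0 *
        Matrix.fromBlocks A B (-(B.map (starRingEnd ℂ))) (A.map (starRingEnd ℂ)) *
        Matrix.fromBlocks 0 (-1) 1 0 := by
    rw [Matrix.fromBlocks_multiply, Matrix.fromBlocks_multiply]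
    ext i j
    rcases i with i | i <;> rcases j with j | j <;> simp
  have h2 : (Matrix.fromBlocks 0 1 (-1) 0 : Matrix (Fin n ⊕ Fin n) (Fin n ⊕ Fin n) ℂ) *
      Matrix.fromBlocks 0 (-1) 1 0 = 1 := by
    rw [Matrix.fromBlocks_multiply]
    simp
  have h3 := congrArg Matrix.det h2
  rw [Matrix.det_mul, Matrix.det_one] at h3
  rw [h1, Matrix.det_mul, Matrix.det_mul, mul_right_comm, h3, one_mul]

lemma TT_det_ne_zero {n : ℕ} (lam : Fin n → ℂ) (hinj : Function.Injective lam)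
    (hil : ∀ j l, (starRingEnd ℂ) (lam j) ≠ Complex.I * lam l ∧
      (starRingEnd ℂ) (lam j) ≠ -(Complex.I * lam l))
    (ε : ℂ) (hε : ε = 1 ∨ ε = -1) (a : Fin n → ℂ × ℂ) (ha : ∀ j, a j ≠ 0) :
    (TT lam (Complex.I * ε) a).det ≠ 0 := by
  intro hdet
  obtain ⟨v, hv0, hv⟩ := Matrix.exists_mulVec_eq_zero_iff.mpr hdet
  set μ := Complex.I * ε with hμ
  have hμμ : μ * (starRingEnd ℂ) μ = 1 := by
    rcases hε with rfl | rfl <;> simp [hμ]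
  have hμ0 : μ ≠ 0 := left_ne_zero_of_mul_eq_one hμμ
  have hne : ∀ j l, (starRingEnd ℂ) (lam j) ≠ μ * lam l := by
    intro j l
    rcases hε with rfl | rfl
    · simpa [hμ] using (hil j l).1
    · simpa [hμ] using (hil j l).2
  have hn : 0 < n := by
    rcases Nat.eq_zero_or_pos n with rfl | h
    · exact absurd (Subsingleton.elim v 0) hv0
    · exact h
  set p := polOf (fun k => v (Sum.inl k)) with hp
  set q := polOf (fun k => v (Sum.inr k)) with hq
  have e1 : ∀ j, (a j).1 * p.eval (lam j) + (a j).2 * q.eval (μ * lam j) = 0 := by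
    intro j
    have := congrFun hv (Sum.inl j)
    simp only [TT, Matrix.mulVec, dotProduct, Fintype.sum_sum_type, Matrix.fromBlocks_apply₁₁,
      Matrix.fromBlocks_apply₁₂, Matrix.of_apply, Pi.zero_apply] at this
    rw [hp, hq, polOf_eval, polOf_eval, Finset.mul_sum, Finset.mul_sum, ← this]
    congr 1 <;> exact Finset.sum_congr rfl fun k _ => by ring
  have e2 : ∀ j, -(starRingEnd ℂ) (a j).2 * p.eval ((starRingEnd ℂ) (μ * lam j)) +
      (starRingEnd ℂ) (a j).1 * q.eval ((starRingEnd ℂ) (lam j)) = 0 := by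
    intro j
    have := congrFun hv (Sum.inr j)
    simp only [TT, Matrix.mulVec, dotProduct, Fintype.sum_sum_type, Matrix.fromBlocks_apply₂₁,
      Matrix.fromBlocks_apply₂₂, Matrix.of_apply, Pi.zero_apply, Matrix.neg_apply,
      Matrix.map_apply, map_mul, map_pow] at this
    rw [hp, hq, polOf_eval, polOf_eval, Finset.mul_sum, Finset.mul_sum, ← this, map_mul]
    congr 1 <;> exact Finset.sum_congr rfl fun k _ => by ring
  set F : Polynomial ℂ := p * (p.map (starRingEnd ℂ)).comp (Polynomial.C μ * Polynomial.X) +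
    q.comp (Polynomial.C μ * Polynomial.X) * q.map (starRingEnd ℂ) with hF
  have conjeval : ∀ (r : Polynomial ℂ) (x : ℂ),
      (r.map (starRingEnd ℂ)).eval x = (starRingEnd ℂ) (r.eval ((starRingEnd ℂ) x)) := by
    intro r x
    have := Polynomial.eval_map_apply (p := r) (starRingEnd ℂ) ((starRingEnd ℂ) x)
    simpa using this
  have Fev : ∀ x, F.eval x = p.eval x * (starRingEnd ℂ) (p.eval ((starRingEnd ℂ) (μ * x))) +
      q.eval (μ * x) * (starRingEnd ℂ) (q.eval ((starRingEnd ℂ) x)) := by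
    intro x
    simp only [hF, Polynomial.eval_add, Polynomial.eval_mul, Polynomial.eval_comp, conjeval,
      Polynomial.eval_C, Polynomial.eval_X]
  have key : ∀ j, F.eval (lam j) = 0 := by
    intro j
    rw [Fev]
    have h1 := e1 j
    have h2 := congrArg (starRingEnd ℂ) (e2 j)
    simp only [map_add, map_mul, map_neg, Complex.conj_conj, map_zero] at h2
    simp only [map_mul]
    set P := p.eval (lam j)
    set Q := q.eval (μ * lam j)
    set P' := (starRingEnd ℂ) (p.eval ((starRingEnd ℂ) μ * (starRingEnd ℂ) (lam j)))
    set Q' := (starRingEnd ℂ) (q.eval ((starRingEnd ℂ) (lam j)))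
    by_cases h : (a j).1 = 0
    · have h' : (a j).2 ≠ 0 := fun h' => ha j (Prod.ext h h')
      apply mul_left_cancel₀ h'
      linear_combination Q' * h1 - P * h2
    · apply mul_left_cancel₀ h
      linear_combination P' * h1 + Q * h2
  have key2 : ∀ j, F.eval ((starRingEnd ℂ) (μ * lam j)) = 0 := by
    intro j
    have h := congrArg (starRingEnd ℂ) (key j)
    rw [Fev] at h ⊢
    have h3 : μ * (starRingEnd ℂ) (μ * lam j) = (starRingEnd ℂ) (lam j) := by
      rw [map_mul, ← mul_assoc, hμμ, one_mul]
    rw [h3]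
    simp only [map_add, map_mul, Complex.conj_conj, map_zero] at h ⊢
    linear_combination h
  have hF0 : F = 0 := by
    apply Polynomial.eq_zero_of_natDegree_lt_card_of_eval_eq_zero F
      (f := Sum.elim lam (fun j => (starRingEnd ℂ) (μ * lam j)))
    · apply Function.Injective.sumElim hinj
      · intro j l h
        exact hinj (mul_left_cancel₀ hμ0 ((starRingEnd ℂ).injective h))
      · intro j l h
        apply hne l j
        rw [h, map_mul, ← mul_assoc, hμμ, one_mul]
    · rintro (j | j)
      · exact key j
      · exact key2 j
    · have dp : p.natDegree ≤ n - 1 := polOf_natDegree _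
      have dq : q.natDegree ≤ n - 1 := polOf_natDegree _
      have dl : (Polynomial.C μ * Polynomial.X : Polynomial ℂ).natDegree ≤ 1 :=
        (Polynomial.natDegree_C_mul_le _ _).trans Polynomial.natDegree_X_le
      have hmap : ∀ r : Polynomial ℂ, (r.map (starRingEnd ℂ)).natDegree ≤ r.natDegree :=
        fun r => Polynomial.natDegree_map_le
      have hcomp : ∀ r : Polynomial ℂ,
          (r.comp (Polynomial.C μ * Polynomial.X)).natDegree ≤ r.natDegree := fun r =>
        Polynomial.natDegree_comp_le.trans (by nlinarith)
      have : F.natDegree ≤ (n - 1) + (n - 1) := by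
        apply Polynomial.natDegree_add_le_of_degree_le
        · exact Polynomial.natDegree_mul_le_of_le dp ((hcomp _).trans ((hmap _).trans dp))
        · exact Polynomial.natDegree_mul_le_of_le ((hcomp _).trans dq) ((hmap _).trans dq)
      simp only [Fintype.card_sum, Fintype.card_fin]
      omega
  set w : ℂ := 1 - μ with hw
  have hw0 : w ≠ 0 := by
    rcases hε with rfl | rfl <;> intro h <;> simpa [hw, hμ] using congrArg Complex.re h
  have hww : μ * w = (starRingEnd ℂ) w := by
    rcases hε with rfl | rfl <;> simp [hw, hμ, mul_sub, mul_add] <;> ring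
  have line : ∀ t : ℝ, p.eval (w * t) = 0 ∧ q.eval ((starRingEnd ℂ) w * t) = 0 := by
    intro t
    have h := Fev (w * t)
    rw [← mul_assoc, hww, hF0] at h
    simp only [map_mul, Complex.conj_conj, Complex.conj_ofReal, Polynomial.eval_zero,
      Complex.mul_conj] at h
    have h' : Complex.normSq (p.eval (w * t)) +
      Complex.normSq (q.eval ((starRingEnd ℂ) w * t)) = 0 := by exact_mod_cast h.symm
    have n1 := Complex.normSq_nonneg (p.eval (w * t))
    have n2 := Complex.normSq_nonneg (q.eval ((starRingEnd ℂ) w * t))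
    exact ⟨Complex.normSq_eq_zero.mp (by linarith), Complex.normSq_eq_zero.mp (by linarith)⟩
  have van : ∀ (r : Polynomial ℂ) (u : ℂ), u ≠ 0 → (∀ t : ℝ, r.eval (u * t) = 0) → r = 0 := by
    intro r u hu h
    apply Polynomial.eq_zero_of_infinite_isRoot
    refine Set.Infinite.mono (s := Set.range fun t : ℝ => u * (t : ℂ)) ?_ ?_
    · rintro _ ⟨t, rfl⟩
      exact h t
    · apply Set.infinite_range_of_injective
      intro s t hst
      exact Complex.ofReal_injective (mul_left_cancel₀ hu hst)
  have p0 : p = 0 := van p w hw0 fun t => (line t).1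
  have q0 : q = 0 := van q _ ((map_ne_zero _).mpr hw0) fun t => (line t).2
  apply hv0
  funext i
  rcases i with i | i
  · exact congrFun (polOf_eq_zero _ p0) i
  · exact congrFun (polOf_eq_zero _ q0) i

lemma TT_smul {n : ℕ} (lam : Fin n → ℂ) (μ : ℂ) (s : Fin n → ℝ) (a : Fin n → ℂ × ℂ) :
    (TT lam μ (fun j => s j • a j)).det = ((∏ j, s j * s j : ℝ) : ℂ) * (TT lam μ a).det := by
  have : TT lam μ (fun j => s j • a j) =
      Matrix.diagonal (Sum.elim (fun j => (s j : ℂ)) (fun j => (s j : ℂ))) * TT lam μ a := by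
    ext i j
    rw [Matrix.diagonal_mul]
    rcases i with i | i <;> rcases j with j | j <;> simp [TT] <;> ring
  rw [this, Matrix.det_mul, Matrix.det_diagonal]
  simp [Fintype.prod_sum_type, Finset.prod_mul_distrib]

lemma TT_cont {n : ℕ} (lam : Fin n → ℂ) (μ : ℂ) :
    Continuous fun a : Fin n → ℂ × ℂ => (TT lam μ a).det := by
  apply Continuous.matrix_det
  apply continuous_matrix
  intro i j
  rcases i with i | i <;> rcases j with j | j <;> simp [TT] <;>
    fun_prop

theorem det_T_uniform_lower_bound (n : ℕ) (lam : Fin n → ℂ)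
    (hinj : Function.Injective lam) (h0 : ∀ j, lam j ≠ 0)
    (hil : ∀ j l, (starRingEnd ℂ) (lam j) ≠ Complex.I * lam l ∧
      (starRingEnd ℂ) (lam j) ≠ -(Complex.I * lam l))
    (ε : ℂ) (hε : ε = 1 ∨ ε = -1) :
    ∃ C : ℝ, 0 < C ∧ ∀ γ : Fin n → ℂ,
      (((Matrix.fromBlocks (Vmat lam) (Matrix.diagonal γ * Vmat lam * Emat n ε)
          (-((Matrix.diagonal γ * Vmat lam * Emat n ε).map (starRingEnd ℂ)))
          ((Vmat lam).map (starRingEnd ℂ))).det).im = 0 ∧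
      C < ((Matrix.fromBlocks (Vmat lam) (Matrix.diagonal γ * Vmat lam * Emat n ε)
          (-((Matrix.diagonal γ * Vmat lam * Emat n ε).map (starRingEnd ℂ)))
          ((Vmat lam).map (starRingEnd ℂ))).det).re) := by
  have hT : ∀ γ : Fin n → ℂ,
      Matrix.fromBlocks (Vmat lam) (Matrix.diagonal γ * Vmat lam * Emat n ε)
          (-((Matrix.diagonal γ * Vmat lam * Emat n ε).map (starRingEnd ℂ)))
          ((Vmat lam).map (starRingEnd ℂ)) =
        TT lam (Complex.I * ε) (fun j => ((1 : ℂ), γ j)) := by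
    intro γ
    have hA : Vmat lam = Matrix.of fun j k : Fin n => (1 : ℂ) * lam j ^ (n - 1 - (k : ℕ)) := by
      ext i j
      simp [Vmat]
    have hB : Matrix.diagonal γ * Vmat lam * Emat n ε =
        Matrix.of fun j k : Fin n => γ j * (Complex.I * ε * lam j) ^ (n - 1 - (k : ℕ)) := by
      ext i j
      rw [Emat, Matrix.mul_diagonal, Matrix.diagonal_mul]
      simp only [Vmat, Matrix.of_apply, mul_pow]
      ring
    rw [hB, hA, TT]
  have hne := TT_det_ne_zero lam hinj hil ε hε
  set μ := Complex.I * ε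
  have him : ∀ a : Fin n → ℂ × ℂ, (TT lam μ a).det.im = 0 := fun a => block_det_im _ _
  -- compactness
  have hK : IsCompact (Set.pi Set.univ fun _ : Fin n => Metric.sphere (0 : ℂ × ℂ) 1) :=
    isCompact_univ_pi fun _ => isCompact_sphere _ _
  obtain ⟨a₀, ha₀, hmin⟩ := hK.exists_isMinOn
    ⟨fun _ => ((1 : ℂ), (0 : ℂ)), fun _ _ => by simp [Prod.norm_def]⟩
    (TT_cont lam μ).norm.continuousOn
  have hc : 0 < ‖(TT lam μ a₀).det‖ := by
    rw [norm_pos_iff]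
    apply hne
    intro j h
    have := ha₀ j (Set.mem_univ _)
    simp [h] at this
  have hlow : ∀ γ : Fin n → ℂ,
      ‖(TT lam μ a₀).det‖ ≤ ‖(TT lam μ (fun j => ((1 : ℂ), γ j))).det‖ := by
    intro γ
    have hs : ∀ j, 1 ≤ ‖((1 : ℂ), γ j)‖ := fun j => by simp [Prod.norm_def]
    have hs0 : ∀ j, ‖((1 : ℂ), γ j)‖ ≠ 0 := fun j => by linarith [hs j]
    have e : (fun j => ((1 : ℂ), γ j)) =
        fun j => ‖((1 : ℂ), γ j)‖ • (‖((1 : ℂ), γ j)‖⁻¹ • ((1 : ℂ), γ j)) := by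
      funext j
      rw [smul_smul, mul_inv_cancel₀ (hs0 j), one_smul]
    rw [e, TT_smul, norm_mul]
    have h1 : ‖(TT lam μ a₀).det‖ ≤
        ‖(TT lam μ (fun j => ‖((1 : ℂ), γ j)‖⁻¹ • ((1 : ℂ), γ j))).det‖ := by
      apply isMinOn_iff.mp hmin
      intro j _
      rw [mem_sphere_zero_iff_norm, norm_smul, norm_inv, norm_norm, inv_mul_cancel₀ (hs0 j)]
    have h2 : 1 ≤ ∏ j, ‖((1 : ℂ), γ j)‖ * ‖((1 : ℂ), γ j)‖ :=
      Finset.prod_induction _ (fun x : ℝ => 1 ≤ x) (fun x y hx hy => by nlinarith) le_rfl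
        fun j _ => by nlinarith [hs j]
    rw [Complex.norm_real, Real.norm_of_nonneg (by linarith)]
    nlinarith [norm_nonneg (TT lam μ a₀).det]
  -- sign
  have hcont : Continuous fun γ : Fin n → ℂ => (TT lam μ (fun j => ((1 : ℂ), γ j))).det.re :=
    Complex.continuous_re.comp ((TT_cont lam μ).comp (by fun_prop))
  have hre : ∀ γ : Fin n → ℂ, (TT lam μ (fun j => ((1 : ℂ), γ j))).det.re ≠ 0 := by
    intro γ h
    exact hne (fun j => ((1 : ℂ), γ j)) (fun j h => by simp at h) (Complex.ext h (him _))
  have hzero : 0 < (TT lam μ (fun j => ((1 : ℂ), (0 : Fin n → ℂ) j))).det.re := by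
    refine lt_of_le_of_ne ?_ (hre 0).symm
    rw [← hT 0]
    have : (Matrix.diagonal (0 : Fin n → ℂ) * Vmat lam * Emat n ε) = 0 := by simp
    rw [this, Matrix.det_fromBlocks_zero₁₂]
    have : ((Vmat lam).map (starRingEnd ℂ)).det = (starRingEnd ℂ) (Vmat lam).det :=
      (RingHom.map_det (starRingEnd ℂ) (Vmat lam)).symm
    rw [this, Complex.mul_conj, Complex.ofReal_re]
    exact Complex.normSq_nonneg _
  have hpos : ∀ γ : Fin n → ℂ, 0 < (TT lam μ (fun j => ((1 : ℂ), γ j))).det.re := by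
    intro γ
    by_contra hneg
    obtain ⟨γ', h'⟩ := mem_range_of_exists_le_of_exists_ge hcont ⟨γ, not_lt.mp hneg⟩ ⟨0, hzero.le⟩
    exact hre γ' h'
  refine ⟨‖(TT lam μ a₀).det‖ / 2, by linarith, fun γ => ?_⟩
  rw [hT γ]
  refine ⟨him _, ?_⟩
  have h1 := hlow γ
  have h2 : ‖(TT lam μ (fun j => ((1 : ℂ), γ j))).det‖ =
      (TT lam μ (fun j => ((1 : ℂ), γ j))).det.re := by
    have : (TT lam μ (fun j => ((1 : ℂ), γ j))).det =
        (((TT lam μ (fun j => ((1 : ℂ), γ j))).det.re : ℝ) : ℂ) :=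
      Complex.ext (by simp) (by simp [him])
    rw [this, Complex.norm_real, Complex.ofReal_re, Real.norm_of_nonneg (hpos γ).le]
  linarith
end

section
/- Let Λ = diag(Λ_1, Λ_2) be a 2n×2n diagonal complex matrix with n×n diagonal blocks satisfying conj(Λ_2) = iε·Λ_1 for some ε ∈ {1,−1}, and let ζ be a column vector in ℂ^{2n}. For j ≥ k define R_{j…k} = [Λ^j ζ, Λ^{j−1} ζ, …, Λ^k ζ] (a 2n×(j−k+1) matrix). Let Π be the 4n×4n block matrix with first block row (Λ^n ζ, Λ^{n−1} ζ, Λ^{n−2} ζ, R_{n−3…0}, K_n·conj(R_{n−1…0}), 0, 0) and second block row (Λ^{n+1} ζ, Λ^n ζ, Λ^{n−1} ζ, 0, 0, R_{n−2…0}, K_n·conj(R_{n−1…0})), where K_n is the 2n×2n matrix (0, −I_n; I_n, 0). Then det Π is purely imaginary, i.e. Re(det Π) = 0. -/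
open Matrix Complex

/-- The `2n × 2n` matrix with blocks `(0, -I_n; I_n, 0)`. -/
noncomputable def Kmat (n : ℕ) : Matrix (Fin (n + n)) (Fin (n + n)) ℂ :=
  Matrix.of fun i j =>
    if (i : ℕ) < n then (if (j : ℕ) = (i : ℕ) + n then -1 else 0)
    else (if (i : ℕ) = (j : ℕ) + n then 1 else 0)

/-- Column `c` of the first (top) block row of `Π`:
`(Λ^n ζ, Λ^(n-1) ζ, Λ^(n-2) ζ, R_{n-3…0}, K_n conj(R_{n-1…0}), 0, 0)`. -/
noncomputable def topVec (n : ℕ) (d : Fin (n + n) → ℂ) (ζ : Fin (n + n) → ℂ) (c : ℕ) :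
    Fin (n + n) → ℂ :=
  if c ≤ n then (Matrix.diagonal d ^ (n - c)) *ᵥ ζ
  else if c ≤ 2 * n then Kmat n *ᵥ star ((Matrix.diagonal d ^ (2 * n - c)) *ᵥ ζ)
  else 0

/-- Column `c` of the second (bottom) block row of `Π`:
`(Λ^(n+1) ζ, Λ^n ζ, Λ^(n-1) ζ, 0, 0, R_{n-2…0}, K_n conj(R_{n-1…0}))`. -/
noncomputable def botVec (n : ℕ) (d : Fin (n + n) → ℂ) (ζ : Fin (n + n) → ℂ) (c : ℕ) :
    Fin (n + n) → ℂ :=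
  if c ≤ 2 then (Matrix.diagonal d ^ (n + 1 - c)) *ᵥ ζ
  else if c ≤ 2 * n then 0
  else if c ≤ 3 * n - 1 then (Matrix.diagonal d ^ (3 * n - 1 - c)) *ᵥ ζ
  else Kmat n *ᵥ star ((Matrix.diagonal d ^ (4 * n - 1 - c)) *ᵥ ζ)

/-- The `4n × 4n` matrix `Π`. -/
noncomputable def PiMat (n : ℕ) (d : Fin (n + n) → ℂ) (ζ : Fin (n + n) → ℂ) :
    Matrix (Fin (4 * n)) (Fin (4 * n)) ℂ :=
  Matrix.of fun i c =>
    if hi : (i : ℕ) < n + n then topVec n d ζ (c : ℕ) ⟨(i : ℕ), hi⟩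
    else botVec n d ζ (c : ℕ) ⟨(i : ℕ) - (n + n), by have := i.isLt; omega⟩


namespace PiAux

variable {n : ℕ}

/-- antilinear map `J v = K conj v`. -/
noncomputable def J (v : Fin n ⊕ Fin n → ℂ) : Fin n ⊕ Fin n → ℂ :=
  Sum.elim (fun k => -(starRingEnd ℂ) (v (Sum.inr k))) (fun k => (starRingEnd ℂ) (v (Sum.inl k)))

/-- powers -/
noncomputable def z (d ζ : Fin n ⊕ Fin n → ℂ) (j : ℕ) : Fin n ⊕ Fin n → ℂ :=
  fun s => d s ^ j * ζ s

/-- the basis matrix -/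
noncomputable def B (d ζ : Fin n ⊕ Fin n → ℂ) : Matrix (Fin n ⊕ Fin n) (Fin n ⊕ Fin n) ℂ :=
  Matrix.of fun s c => Sum.elim (fun k : Fin n => z d ζ (n - 1 - k) s)
    (fun k : Fin n => J (z d ζ (n - 1 - k)) s) c

theorem J_J (v : Fin n ⊕ Fin n → ℂ) : J (J v) = -v := by
  funext s; rcases s with k | k <;> simp [J]

theorem B_mulVec (d ζ x : Fin n ⊕ Fin n → ℂ) (s : Fin n ⊕ Fin n) :
    (B d ζ *ᵥ x) s = ∑ k : Fin n, x (Sum.inl k) * z d ζ (n - 1 - k) s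
      + ∑ k : Fin n, x (Sum.inr k) * J (z d ζ (n - 1 - k)) s := by
  simp [B, Matrix.mulVec, dotProduct, Fintype.sum_sum_type, mul_comm]

theorem B_J (d ζ x : Fin n ⊕ Fin n → ℂ) : B d ζ *ᵥ (J x) = J (B d ζ *ᵥ x) := by
  funext s
  rw [B_mulVec]
  rcases s with k | k <;>
  simp [J, B_mulVec, Finset.sum_add_distrib, Finset.sum_neg_distrib] <;> ring

/-- matrix K -/
noncomputable def K (n : ℕ) : Matrix (Fin n ⊕ Fin n) (Fin n ⊕ Fin n) ℂ :=
  Matrix.fromBlocks 0 (-1) 1 0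

theorem K_mulVec (v : Fin n ⊕ Fin n → ℂ) : K n *ᵥ star v = J v := by
  funext s
  rcases s with k | k
  · simp [K, Matrix.fromBlocks_mulVec, J, Matrix.neg_mulVec]
  · simp [K, Matrix.fromBlocks_mulVec, J]

theorem detK : (K n).det ≠ 0 := by
  intro h
  have : K n * (-(K n)) = 1 := by
    rw [K, Matrix.fromBlocks_neg, Matrix.fromBlocks_multiply]
    simp
  have h2 := congrArg Matrix.det this
  rw [Matrix.det_mul, h] at h2
  simp at h2

theorem detB_real (d ζ : Fin n ⊕ Fin n → ℂ) : (starRingEnd ℂ) (B d ζ).det = (B d ζ).det := by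
  have h : K n * (B d ζ).map (starRingEnd ℂ) = B d ζ * K n := by
    refine Matrix.ext_of_mulVec_single ?_
    intro i
    have h1 : ∀ v : Fin n ⊕ Fin n → ℂ, (B d ζ).map (starRingEnd ℂ) *ᵥ star v
        = star (B d ζ *ᵥ v) := by
      intro v; funext s
      simp [Matrix.mulVec, dotProduct]
    have h2 : (Pi.single i 1 : Fin n ⊕ Fin n → ℂ) = star (Pi.single i 1) := by
      rw [← Pi.single_star]; simp
    rw [← Matrix.mulVec_mulVec, ← Matrix.mulVec_mulVec, h2, h1, K_mulVec, K_mulVec, B_J]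
  have h2 := congrArg Matrix.det h
  rw [Matrix.det_mul, Matrix.det_mul, mul_comm] at h2
  have h3 := mul_right_cancel₀ detK h2
  rw [RingHom.map_det]
  exact h3

theorem exists_ker (d ζ : Fin n ⊕ Fin n → ℂ) (k0 : Fin n) (h : (B d ζ).det = 0) :
    ∃ x, x ≠ 0 ∧ B d ζ *ᵥ x = 0 ∧ x (Sum.inl k0) = 0 := by
  obtain ⟨x, hx, hB⟩ := Matrix.exists_mulVec_eq_zero_iff.mpr h
  by_cases h0 : x (Sum.inl k0) = 0
  · exact ⟨x, hx, hB, h0⟩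
  have hJ0 : B d ζ *ᵥ (J x) = 0 := by
    rw [B_J, hB]; funext s; rcases s with k | k <;> simp [J]
  refine ⟨J x (Sum.inl k0) • x - x (Sum.inl k0) • J x, ?_, ?_, ?_⟩
  · intro hz
    have e1 := congrFun hz (Sum.inl k0)
    have e2 := congrFun hz (Sum.inr k0)
    simp only [J, Sum.elim_inl, Sum.elim_inr, Pi.sub_apply, Pi.smul_apply, smul_eq_mul, Pi.zero_apply] at e2
    have e3 : ((Complex.normSq (x (Sum.inr k0)) + Complex.normSq (x (Sum.inl k0)) : ℝ) : ℂ) = 0 := by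
      push_cast
      rw [← Complex.mul_conj, ← Complex.mul_conj]
      linear_combination -e2
    have e4 : Complex.normSq (x (Sum.inr k0)) + Complex.normSq (x (Sum.inl k0)) = 0 := by
      exact_mod_cast e3
    have := Complex.normSq_nonneg (x (Sum.inr k0))
    have := Complex.normSq_pos.mpr h0
    linarith
  · rw [Matrix.mulVec_sub, Matrix.mulVec_smul, Matrix.mulVec_smul, hB, hJ0]; simp
  · simp; ring

theorem J_z_succ (d ζ : Fin n ⊕ Fin n → ℂ) (ω : ℂ) (hω : ω * ω = -1)
    (h1 : ∀ k, (starRingEnd ℂ) (d (Sum.inr k)) = ω * d (Sum.inl k))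
    (h2 : ∀ k, (starRingEnd ℂ) (d (Sum.inl k)) = ω * d (Sum.inr k)) (j : ℕ)
    (s : Fin n ⊕ Fin n) :
    d s * J (z d ζ j) s = -ω * J (z d ζ (j+1)) s := by
  rcases s with k | k
  · simp [J, z, h1, pow_succ]
    linear_combination (-(ω * d (Sum.inl k)) ^ j * (starRingEnd ℂ) (ζ (Sum.inr k)) * d (Sum.inl k)) * hω
  · simp [J, z, h2, pow_succ]
    linear_combination ((ω * d (Sum.inr k)) ^ j * (starRingEnd ℂ) (ζ (Sum.inl k)) * d (Sum.inr k)) * hω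

/-- lower-left block -/
noncomputable def C {m : ℕ} (d ζ : Fin (m+2) ⊕ Fin (m+2) → ℂ) :
    Matrix (Fin (m+2) ⊕ Fin (m+2)) (Fin (m+2) ⊕ Fin (m+2)) ℂ :=
  Matrix.of fun s c => if c = Sum.inl 0 then z d ζ (m+2) s
    else if c = Sum.inl 1 then z d ζ (m+1) s else 0

/-- upper-right block -/
noncomputable def U {m : ℕ} (d ζ : Fin (m+2) ⊕ Fin (m+2) → ℂ) :
    Matrix (Fin (m+2) ⊕ Fin (m+2)) (Fin (m+2) ⊕ Fin (m+2)) ℂ :=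
  Matrix.of fun s c => if c = Sum.inl 0 then z d ζ (m+2) s else 0

theorem key {m : ℕ} (d ζ w : Fin (m+2) ⊕ Fin (m+2) → ℂ) (ω : ℂ) (hω : ω * ω = -1)
    (h1 : ∀ k, (starRingEnd ℂ) (d (Sum.inr k)) = ω * d (Sum.inl k))
    (h2 : ∀ k, (starRingEnd ℂ) (d (Sum.inl k)) = ω * d (Sum.inr k))
    (hw : B d ζ *ᵥ w = z d ζ (m+2)) :
    ∃ v, v (Sum.inl 0) = ω * Complex.normSq (w (Sum.inr 0)) ∧
      B d ζ *ᵥ v = z d ζ (m+3) - C d ζ *ᵥ w := by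
  let s0 : Fin (m+2) ⊕ Fin (m+2) → ℂ := Sum.elim
    (Fin.cons 0 (Fin.snoc (fun k : Fin m => w (Sum.inl k.succ.succ)) 0 : Fin (m+1) → ℂ))
    (Fin.snoc (fun k : Fin (m+1) => -ω * w (Sum.inr k.succ)) 0 : Fin (m+2) → ℂ)
  refine ⟨s0 + (-ω * w (Sum.inr 0)) • J w, ?_, ?_⟩
  · simp [s0, J]
    rw [← Complex.mul_conj]; ring
  · rw [Matrix.mulVec_add, Matrix.mulVec_smul, B_J, hw]
    funext s
    have hz : z d ζ (m+3) s = d s * z d ζ (m+2) s := by simp [z]; ring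
    have hC : (C d ζ *ᵥ w) s = w (Sum.inl 0) * z d ζ (m+2) s + w (Sum.inl 1) * z d ζ (m+1) s := by
      simp only [Matrix.mulVec, dotProduct]
      rw [Fintype.sum_sum_type, Fin.sum_univ_succ, Fin.sum_univ_succ]
      have hne : ∀ k : Fin m, k.succ.succ ≠ 1 := fun k h => by
        have := congrArg Fin.val h
        simp at this
      simp [C, hne]
      ring
    have hzs : ∀ j, d s * z d ζ j s = z d ζ (j+1) s := by intro j; simp [z]; ring
    have hws := congrFun hw s
    have hdz : d s * z d ζ (m+2) s = d s * (B d ζ *ᵥ w) s := by rw [hws]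
    rw [Pi.sub_apply, hz, hdz, hC, B_mulVec, Pi.add_apply, B_mulVec, mul_add, Finset.mul_sum,
      Finset.mul_sum]
    have e1 : ∑ k : Fin (m+2), d s * (w (Sum.inl k) * z d ζ (m + 2 - 1 - k) s)
        = w (Sum.inl 0) * z d ζ (m+2) s + w (Sum.inl 1) * z d ζ (m+1) s
        + ∑ k : Fin m, w (Sum.inl k.succ.succ) * z d ζ (m - k) s := by
      rw [Fin.sum_univ_succ, Fin.sum_univ_succ, ← add_assoc]
      congr 1
      · congr 1
        · rw [mul_left_comm, hzs]; simp
        · rw [mul_left_comm, hzs]; simp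
      · refine Finset.sum_congr rfl fun k _ => ?_
        rw [mul_left_comm, hzs]
        congr 2
        simp only [Fin.val_succ]; omega
    have e2 : ∑ k : Fin (m+2), d s * (w (Sum.inr k) * J (z d ζ (m + 2 - 1 - k)) s)
        = -ω * w (Sum.inr 0) * J (z d ζ (m+2)) s
        + ∑ k : Fin (m+1), -ω * w (Sum.inr k.succ) * J (z d ζ (m + 1 - k)) s := by
      rw [Fin.sum_univ_succ]
      congr 1
      · rw [mul_left_comm, J_z_succ d ζ ω hω h1 h2]; simp; ring
      · refine Finset.sum_congr rfl fun k _ => ?_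
        rw [mul_left_comm, J_z_succ d ζ ω hω h1 h2]
        have : m + 2 - 1 - (k.succ : ℕ) + 1 = m + 1 - k := by
          simp only [Fin.val_succ]; omega
        rw [this]; ring
    have e3 : ∑ k : Fin (m+2), s0 (Sum.inl k) * z d ζ (m + 2 - 1 - k) s
        = ∑ k : Fin m, w (Sum.inl k.succ.succ) * z d ζ (m - k) s := by
      rw [Fin.sum_univ_succ, Fin.sum_univ_castSucc]
      simp only [s0, Sum.elim_inl, Fin.cons_zero, Fin.cons_succ, Fin.snoc_castSucc, Fin.snoc_last,
        zero_mul, zero_add, add_zero]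
      refine Finset.sum_congr rfl fun k _ => ?_
      congr 2
      simp only [Fin.val_succ, Fin.val_castSucc]; omega
    have e4 : ∑ k : Fin (m+2), s0 (Sum.inr k) * J (z d ζ (m + 2 - 1 - k)) s
        = ∑ k : Fin (m+1), -ω * w (Sum.inr k.succ) * J (z d ζ (m + 1 - k)) s := by
      rw [Fin.sum_univ_castSucc]
      simp only [s0, Sum.elim_inr, Fin.snoc_castSucc, Fin.snoc_last, zero_mul, add_zero]
      refine Finset.sum_congr rfl fun k _ => ?_
      congr 3
    rw [e1, e2, e3, e4]
    simp only [Pi.smul_apply, smul_eq_mul]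
    ring

theorem core {m : ℕ} (d ζ : Fin (m+2) ⊕ Fin (m+2) → ℂ) (ω : ℂ) (hω : ω * ω = -1) (hre : ω.re = 0)
    (h1 : ∀ k, (starRingEnd ℂ) (d (Sum.inr k)) = ω * d (Sum.inl k))
    (h2 : ∀ k, (starRingEnd ℂ) (d (Sum.inl k)) = ω * d (Sum.inr k)) :
    (Matrix.fromBlocks (B d ζ) (U d ζ) (C d ζ)
      ((B d ζ).updateCol (Sum.inl 0) (z d ζ (m+3)))).det.re = 0 := by
  by_cases hD : (B d ζ).det = 0
  · obtain ⟨x, hx, hBx, hx0⟩ := exists_ker d ζ 0 hD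
    have : (Matrix.fromBlocks (B d ζ) (U d ζ) (C d ζ)
      ((B d ζ).updateCol (Sum.inl 0) (z d ζ (m+3)))).det = 0 := by
      rw [← Matrix.exists_mulVec_eq_zero_iff]
      refine ⟨Sum.elim 0 x, ?_, ?_⟩
      · intro h
        apply hx
        funext s
        exact congrFun h (Sum.inr s)
      · rw [Matrix.fromBlocks_mulVec]
        have hU : U d ζ *ᵥ x = 0 := by
          funext s
          simp only [U, Matrix.mulVec, dotProduct, Matrix.of_apply, Pi.zero_apply]
          refine Finset.sum_eq_zero fun c _ => ?_
          split_ifs with hc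
          · rw [hc, hx0, mul_zero]
          · simp
        have hU' : (B d ζ).updateCol (Sum.inl 0) (z d ζ (m+3)) *ᵥ x = 0 := by
          rw [← hBx]
          funext s
          simp only [Matrix.mulVec, dotProduct]
          refine Finset.sum_congr rfl fun c _ => ?_
          by_cases hc : c = Sum.inl 0
          · rw [hc, hx0, mul_zero, mul_zero]
          · rw [Matrix.updateCol_ne hc]
        simp only [Sum.elim_comp_inl, Sum.elim_comp_inr, hU, hU', Matrix.mulVec_zero]
        funext s
        rcases s with s | s <;> simp
    rw [this]; simp
  · have hu : IsUnit (B d ζ).det := isUnit_iff_ne_zero.mpr hD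
    haveI : Invertible (B d ζ) := Matrix.invertibleOfIsUnitDet _ hu
    set w := (B d ζ)⁻¹ *ᵥ z d ζ (m+2) with hwdef
    have hw : B d ζ *ᵥ w = z d ζ (m+2) := by
      rw [hwdef, Matrix.mulVec_mulVec, Matrix.mul_nonsing_inv _ hu, Matrix.one_mulVec]
    obtain ⟨v, hv0, hv⟩ := key d ζ w ω hω h1 h2 hw
    have hS : (B d ζ).updateCol (Sum.inl 0) (z d ζ (m+3)) - C d ζ * ⅟(B d ζ) * U d ζ
        = (B d ζ).updateCol (Sum.inl 0) (B d ζ *ᵥ v) := by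
      rw [hv, Matrix.invOf_eq_nonsing_inv, Matrix.mul_assoc]
      have hBU : ∀ s c, ((B d ζ)⁻¹ * U d ζ) s c = if c = Sum.inl 0 then w s else 0 := by
        intro s c
        simp only [Matrix.mul_apply, U, Matrix.of_apply]
        split_ifs with hc
        · rfl
        · simp
      ext s c
      rw [Matrix.sub_apply, Matrix.mul_apply]
      simp only [hBU]
      by_cases hc : c = Sum.inl 0
      · simp [hc, Matrix.mulVec, dotProduct]
      · simp [hc, Matrix.updateCol_ne hc]
    have hcr : ((B d ζ).updateCol (Sum.inl 0) (B d ζ *ᵥ v)).det = (B d ζ).det * v (Sum.inl 0) := by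
      rw [← Matrix.cramer_apply, Matrix.cramer_eq_adjugate_mulVec, Matrix.mulVec_mulVec,
        Matrix.adjugate_mul, Matrix.smul_mulVec, Matrix.one_mulVec]
      rfl
    rw [Matrix.det_fromBlocks₁₁, hS, hcr, hv0]
    obtain ⟨r, hr⟩ := Complex.conj_eq_iff_real.mp (detB_real d ζ)
    rw [hr]
    simp [hre]

/-- rows -/
def rowF (n : ℕ) : (Fin n ⊕ Fin n) ⊕ (Fin n ⊕ Fin n) → Fin (4 * n)
  | Sum.inl (Sum.inl k) => ⟨k, by have := k.isLt; omega⟩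
  | Sum.inl (Sum.inr k) => ⟨n + k, by have := k.isLt; omega⟩
  | Sum.inr (Sum.inl k) => ⟨2 * n + k, by have := k.isLt; omega⟩
  | Sum.inr (Sum.inr k) => ⟨3 * n + k, by have := k.isLt; omega⟩

/-- columns -/
def colF (n : ℕ) : (Fin n ⊕ Fin n) ⊕ (Fin n ⊕ Fin n) → Fin (4 * n)
  | Sum.inl (Sum.inl k) => ⟨1 + k, by have := k.isLt; omega⟩
  | Sum.inl (Sum.inr k) => ⟨n + 1 + k, by have := k.isLt; omega⟩
  | Sum.inr (Sum.inl k) => ⟨if (k : ℕ) = 0 then 0 else 2 * n + k, by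
      have := k.isLt; split_ifs <;> omega⟩
  | Sum.inr (Sum.inr k) => ⟨3 * n + k, by have := k.isLt; omega⟩

theorem rowF_bij (n : ℕ) : Function.Bijective (rowF n) := by
  rw [Fintype.bijective_iff_injective_and_card]
  constructor
  · rintro ((a | a) | (a | a)) ((b | b) | (b | b)) h <;>
    simp only [rowF, Fin.mk.injEq] at h <;> have := a.isLt <;> have := b.isLt <;>
    first
    | (exfalso; omega)
    | (have : a = b := Fin.ext (by omega)
       rw [this])
  · simp; ring

theorem colF_bij (n : ℕ) : Function.Bijective (colF n) := by
  rw [Fintype.bijective_iff_injective_and_card]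
  constructor
  · rintro ((a | a) | (a | a)) ((b | b) | (b | b)) h <;>
    simp only [colF, Fin.mk.injEq] at h <;> have := a.isLt <;> have := b.isLt <;>
    first
    | (exfalso; omega)
    | (exfalso; split_ifs at h <;> omega)
    | (have : a = b := Fin.ext (by first | omega | (split_ifs at h <;> omega))
       rw [this])
  · simp; ring

/-- index -/
def idx (n : ℕ) : Fin n ⊕ Fin n → Fin (n + n)
  | Sum.inl k => Fin.castAdd n k
  | Sum.inr k => Fin.natAdd n k

theorem pow_vec (d ζ : Fin (n + n) → ℂ) (j : ℕ) (i : Fin (n + n)) :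
    ((Matrix.diagonal d ^ j) *ᵥ ζ) i = d i ^ j * ζ i := by
  rw [Matrix.diagonal_pow, Matrix.mulVec_diagonal]; rfl

theorem Kvec (d ζ : Fin (n + n) → ℂ) (j : ℕ) (s : Fin n ⊕ Fin n) :
    (Kmat n *ᵥ star ((Matrix.diagonal d ^ j) *ᵥ ζ)) (idx n s)
      = J (z (d ∘ idx n) (ζ ∘ idx n) j) s := by
  rcases s with k | k
  · have := k.isLt
    simp only [Matrix.mulVec, dotProduct]
    rw [Finset.sum_eq_single (idx n (Sum.inr k))]
    · have e := pow_vec d ζ j (idx n (Sum.inr k))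
      simp only [Pi.star_apply, e]
      simp [Kmat, idx, J, z, add_comm]
    · intro b _ hb
      have : ¬ ((b : ℕ) = k + n) := fun h => hb (Fin.ext (by simp [idx]; omega))
      simp [Kmat, idx, this]
    · simp
  · have := k.isLt
    simp only [Matrix.mulVec, dotProduct]
    rw [Finset.sum_eq_single (idx n (Sum.inl k))]
    · have e := pow_vec d ζ j (idx n (Sum.inl k))
      simp only [Pi.star_apply, e]
      simp [Kmat, idx, J, z, add_comm]
    · intro b _ hb
      have : ¬ ((k : ℕ) = b) := fun h => hb (Fin.ext (by simp [idx]; omega))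
      simp [Kmat, idx, this]
    · simp

theorem Pi_top (d ζ : Fin (n + n) → ℂ) (s : Fin n ⊕ Fin n) (c : Fin (4 * n)) :
    PiMat n d ζ (rowF n (Sum.inl s)) c = topVec n d ζ c (idx n s) := by
  rcases s with k | k
  · have : (k : ℕ) < n + n := by omega
    simp [PiMat, rowF, idx, this]
    exact congrArg _ (Fin.ext (by simp))
  · simp [PiMat, rowF, idx]
    exact congrArg _ (Fin.ext (by simp [add_comm]))

theorem Pi_bot (d ζ : Fin (n + n) → ℂ) (s : Fin n ⊕ Fin n) (c : Fin (4 * n)) :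
    PiMat n d ζ (rowF n (Sum.inr s)) c = botVec n d ζ c (idx n s) := by
  rcases s with k | k
  · have h : ¬ (2 * n + (k : ℕ) < n + n) := by omega
    have h' : 2 * n + (k : ℕ) - (n + n) = k := by omega
    simp [PiMat, rowF, idx, h, h']
    exact congrArg _ (Fin.ext (by simp [add_comm]))
  · have h : ¬ (3 * n + (k : ℕ) < n + n) := by omega
    have h' : 3 * n + (k : ℕ) - (n + n) = n + k := by omega
    simp [PiMat, rowF, idx, h, h']
    exact congrArg _ (Fin.ext (by simp [add_comm]))

theorem Pi_blocks {m : ℕ} (d ζ : Fin ((m+2) + (m+2)) → ℂ) :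
    (PiMat (m+2) d ζ).submatrix (rowF (m+2)) (colF (m+2)) =
    Matrix.fromBlocks (B (d ∘ idx (m+2)) (ζ ∘ idx (m+2))) (U (d ∘ idx (m+2)) (ζ ∘ idx (m+2)))
      (C (d ∘ idx (m+2)) (ζ ∘ idx (m+2)))
      ((B (d ∘ idx (m+2)) (ζ ∘ idx (m+2))).updateCol (Sum.inl 0)
        (z (d ∘ idx (m+2)) (ζ ∘ idx (m+2)) (m+3))) := by
  have hpz : ∀ j s, ((Matrix.diagonal d ^ j) *ᵥ ζ) (idx (m+2) s)
      = z (d ∘ idx (m+2)) (ζ ∘ idx (m+2)) j s := by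
    intro j s; rw [pow_vec]; rfl
  ext (s | s) ((k | k) | (k | k)) <;> have hk := k.isLt <;>
    simp only [Matrix.submatrix_apply, Pi_top, Pi_bot, Matrix.fromBlocks_apply₁₁,
      Matrix.fromBlocks_apply₁₂, Matrix.fromBlocks_apply₂₁, Matrix.fromBlocks_apply₂₂, colF]
  · rw [topVec, if_pos (by omega), hpz]
    simp only [B, Matrix.of_apply, Sum.elim_inl]
    congr 1; omega
  · rw [topVec, if_neg (by omega), if_pos (by omega), Kvec]
    simp only [B, Matrix.of_apply, Sum.elim_inr]
    congr 2; omega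
  · by_cases h0 : (k : ℕ) = 0
    · have : k = 0 := Fin.ext h0
      subst this
      simp [topVec, U, hpz]
    · have h0' : k ≠ 0 := fun h => h0 (by simp [h])
      rw [if_neg h0, topVec, if_neg (by omega), if_neg (by omega)]
      simp [U, h0']
  · rw [topVec, if_neg (by omega), if_neg (by omega)]
    simp [U]
  · by_cases h0 : (k : ℕ) = 0
    · have : k = 0 := Fin.ext h0
      subst this
      simp [botVec, C, hpz]
    · have h0' : k ≠ 0 := fun h => h0 (by simp [h])
      by_cases h1 : (k : ℕ) = 1
      · have : k = 1 := Fin.ext h1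
        subst this
        simp [botVec, C, hpz]
      · have h1' : k ≠ 1 := fun h => h1 (by simp [h])
        rw [botVec, if_neg (by omega), if_pos (by omega)]
        simp [C, h0', h1']
  · rw [botVec, if_neg (by omega), if_pos (by omega)]
    simp [C]
  · by_cases h0 : (k : ℕ) = 0
    · have : k = 0 := Fin.ext h0
      subst this
      simp [botVec, hpz]
    · have h0' : k ≠ 0 := fun h => h0 (by simp [h])
      rw [if_neg h0, botVec, if_neg (by omega), if_neg (by omega), if_pos (by omega), hpz,
        Matrix.updateCol_ne (by simpa using h0')]
      simp only [B, Matrix.of_apply, Sum.elim_inl]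
      congr 1; omega
  · rw [botVec, if_neg (by omega), if_neg (by omega), if_neg (by omega), Kvec,
        Matrix.updateCol_ne (by simp)]
    simp only [B, Matrix.of_apply, Sum.elim_inr]
    congr 2; omega

theorem det_sub_re {ι κ : Type*} [Fintype ι] [DecidableEq ι] [Fintype κ] [DecidableEq κ]
    (A : Matrix ι ι ℂ) (e f : κ ≃ ι) (h : (A.submatrix e f).det.re = 0) : A.det.re = 0 := by
  have h1 : A.submatrix e f = (A.submatrix e e).submatrix id (f.trans e.symm) := by
    ext i j; simp
  rw [h1, Matrix.det_permute', Matrix.det_submatrix_equiv_self] at h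
  rcases Int.units_eq_one_or (Equiv.Perm.sign (f.trans e.symm)) with hs | hs <;>
    rw [hs] at h <;> simpa using h

end PiAux

theorem re_det_Pi_eq_zero (n : ℕ) (hn : 2 ≤ n)
    (d : Fin (n + n) → ℂ) (ζ : Fin (n + n) → ℂ) (ε : ℂ) (hε : ε = 1 ∨ ε = -1)
    (hd : ∀ j : Fin n,
      (starRingEnd ℂ) (d ⟨n + (j : ℕ), by have := j.isLt; omega⟩) =
        Complex.I * ε * d ⟨(j : ℕ), by have := j.isLt; omega⟩) :
    ((PiMat n d ζ).det).re = 0 := by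
  obtain ⟨m, rfl⟩ : ∃ m, n = m + 2 := ⟨n - 2, by omega⟩
  have hω : (Complex.I * ε) * (Complex.I * ε) = -1 := by
    rcases hε with rfl | rfl <;> simp
  have hcω : (starRingEnd ℂ) (Complex.I * ε) = -(Complex.I * ε) := by
    rcases hε with rfl | rfl <;> simp
  have hre : (Complex.I * ε).re = 0 := by
    rcases hε with rfl | rfl <;> simp
  apply PiAux.det_sub_re _ (Equiv.ofBijective _ (PiAux.rowF_bij (m+2)))
    (Equiv.ofBijective _ (PiAux.colF_bij (m+2)))
  have := PiAux.Pi_blocks d ζ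
  simp only [Equiv.ofBijective_apply, Equiv.coe_ofBijective] at *
  rw [this]
  refine PiAux.core _ _ (Complex.I * ε) hω hre (fun k => hd k) (fun k => ?_)
  have h := congrArg (starRingEnd ℂ) (hd k)
  rw [Complex.conj_conj, map_mul, hcω] at h
  change (starRingEnd ℂ) (d ⟨(k : ℕ), _⟩) = Complex.I * ε * d ⟨(m + 2) + (k : ℕ), _⟩
  rw [h]
  linear_combination ((starRingEnd ℂ) (d ⟨(k : ℕ), by have := k.isLt; omega⟩)) * hω
end

section
/- Let Λ = diag(Λ_1, Λ_2) with conj(Λ_2) = iε·Λ_1 (ε = ±1), ζ ∈ ℂ^{2n}, and R_{j…k} = [Λ^j ζ, …, Λ^k ζ] as above. Then det Π = iε · det[R_{n…0} | K_n·conj(R_{n−2…0})] · det[R_{n−2…0} | K_n·conj(R_{n…0})], where Π is the 4n×4n matrix defined from the two block rows (Λ^n ζ, Λ^{n−1} ζ, Λ^{n−2} ζ, R_{n−3…0}, K_n·conj(R_{n−1…0}), 0, 0) and (Λ^{n+1} ζ, Λ^n ζ, Λ^{n−1} ζ, 0, 0, R_{n−2…0}, K_n·conj(R_{n−1…0})).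 -/
open Matrix Complex

/-- The `2n × 2n` matrix `[R_{n…0} | K_n conj(R_{n-2…0})]`. -/
noncomputable def M1 (n : ℕ) (d : Fin (n + n) → ℂ) (ζ : Fin (n + n) → ℂ) :
    Matrix (Fin (n + n)) (Fin (n + n)) ℂ :=
  Matrix.of fun i c =>
    if (c : ℕ) ≤ n then ((Matrix.diagonal d ^ (n - (c : ℕ))) *ᵥ ζ) i
    else (Kmat n *ᵥ star ((Matrix.diagonal d ^ (2 * n - 1 - (c : ℕ))) *ᵥ ζ)) i

/-- The `2n × 2n` matrix `[R_{n-2…0} | K_n conj(R_{n…0})]`. -/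
noncomputable def M2 (n : ℕ) (d : Fin (n + n) → ℂ) (ζ : Fin (n + n) → ℂ) :
    Matrix (Fin (n + n)) (Fin (n + n)) ℂ :=
  Matrix.of fun i c =>
    if (c : ℕ) + 2 ≤ n then ((Matrix.diagonal d ^ (n - 2 - (c : ℕ))) *ᵥ ζ) i
    else (Kmat n *ᵥ star ((Matrix.diagonal d ^ (2 * n - 1 - (c : ℕ))) *ᵥ ζ)) i

/-- The vector `Λ^k ζ`. -/
noncomputable def avec (n : ℕ) (d : Fin (n + n) → ℂ) (ζ : Fin (n + n) → ℂ) (k : ℕ) :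
    Fin (n + n) → ℂ := (Matrix.diagonal d ^ k) *ᵥ ζ

/-- The vector `K conj(Λ^k ζ)`. -/
noncomputable def bvec (n : ℕ) (d : Fin (n + n) → ℂ) (ζ : Fin (n + n) → ℂ) (k : ℕ) :
    Fin (n + n) → ℂ := Kmat n *ᵥ star ((Matrix.diagonal d ^ k) *ᵥ ζ)

lemma avec_apply (n : ℕ) (d ζ : Fin (n + n) → ℂ) (k : ℕ) (i : Fin (n + n)) :
    avec n d ζ k i = d i ^ k * ζ i := by
  simp [avec, Matrix.diagonal_pow, Matrix.mulVec_diagonal]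

lemma avec_succ (n : ℕ) (d ζ : Fin (n + n) → ℂ) (k : ℕ) (i : Fin (n + n)) :
    d i * avec n d ζ k i = avec n d ζ (k + 1) i := by
  rw [avec_apply, avec_apply]; ring

lemma bvec_lo (n : ℕ) (d ζ : Fin (n + n) → ℂ) (k : ℕ) (i : Fin (n + n)) (hi : (i : ℕ) < n) :
    bvec n d ζ k i = - (starRingEnd ℂ) (avec n d ζ k ⟨n + i, by omega⟩) := by
  change (∑ j, Kmat n i j * (starRingEnd ℂ) (avec n d ζ k j)) = _
  rw [Finset.sum_eq_single (⟨n + i, by omega⟩ : Fin (n + n))]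
  · simp [Kmat, hi, add_comm]
  · intro j _ hj
    have : (j : ℕ) ≠ i + n := fun h => hj (Fin.ext (by simp; omega))
    simp [Kmat, hi, this]
  · simp

lemma bvec_hi (n : ℕ) (d ζ : Fin (n + n) → ℂ) (k : ℕ) (i : Fin (n + n)) (hi : ¬ (i : ℕ) < n) :
    bvec n d ζ k i = (starRingEnd ℂ) (avec n d ζ k ⟨i - n, by omega⟩) := by
  change (∑ j, Kmat n i j * (starRingEnd ℂ) (avec n d ζ k j)) = _
  rw [Finset.sum_eq_single (⟨i - n, by omega⟩ : Fin (n + n))]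
  · have : (i : ℕ) = i - n + n := by omega
    simp [Kmat, hi, ← this]
  · intro j _ hj
    have : (i : ℕ) ≠ j + n := fun h => hj (Fin.ext (by simp; omega))
    simp [Kmat, hi, this]
  · simp

lemma bvec_succ (n : ℕ) (d ζ : Fin (n + n) → ℂ) (ε : ℂ) (hε : ε = 1 ∨ ε = -1)
    (hd : ∀ i j : Fin (n + n), (j : ℕ) = n + i →
      (starRingEnd ℂ) (d j) = Complex.I * ε * d i) (k : ℕ) (i : Fin (n + n)) :
    d i * bvec n d ζ k i = -(Complex.I * ε) * bvec n d ζ (k + 1) i := by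
  have hε2 : ε * ε = 1 := by rcases hε with rfl | rfl <;> simp
  have hεs : (starRingEnd ℂ) ε = ε := by rcases hε with rfl | rfl <;> simp
  have hI := Complex.I_mul_I
  by_cases hi : (i : ℕ) < n
  · rw [bvec_lo _ _ _ _ _ hi, bvec_lo _ _ _ _ _ hi, ← avec_succ, map_mul]
    have h := hd i ⟨n + i, by omega⟩ rfl
    rw [h]
    linear_combination ((d i) * (starRingEnd ℂ) (avec n d ζ k ⟨n + i, by omega⟩)) * (-ε * ε * hI + hε2)
  · rw [bvec_hi _ _ _ _ _ hi, bvec_hi _ _ _ _ _ hi, ← avec_succ, map_mul]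
    have h := hd ⟨i - n, by omega⟩ i (by simp; omega)
    have h2 := congrArg (starRingEnd ℂ) h
    simp only [Complex.conj_conj, map_mul, Complex.conj_I, hεs] at h2
    rw [h2]; ring

/-- The column permutation on indices. -/
def colIdx (n c : ℕ) : ℕ :=
  if c ≤ n then c else if c < 3 * n - 1 then c + 1 else if c = 3 * n - 1 then n + 1 else c

lemma cycle_val (n : ℕ) (hn : 2 ≤ n) (c : Fin (4 * n)) :
    ((Fin.cycleIcc (⟨n + 1, by omega⟩ : Fin (4 * n)) ⟨3 * n - 1, by omega⟩ c : Fin (4 * n)) : ℕ)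
      = colIdx n c := by
  have : NeZero (4 * n) := ⟨by omega⟩
  unfold colIdx
  split_ifs with h1 h2 h3
  · rw [Fin.cycleIcc_of_lt (by rw [Fin.lt_def]; simp; omega)]
  · rw [Fin.cycleIcc_of_ge_of_lt (by rw [Fin.le_def]; simp; omega) (by rw [Fin.lt_def]; simpa)]
    rw [Fin.val_add_one_of_lt']
    omega
  · have : c = ⟨3 * n - 1, by omega⟩ := Fin.ext h3
    rw [this, Fin.cycleIcc_of_last (by rw [Fin.le_def]; simp; omega)]
  · rw [Fin.cycleIcc_of_gt (by rw [Fin.lt_def]; simp; omega)]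

/-- index splitting -/
def splitE (n : ℕ) : Fin (n + n) ⊕ Fin (n + n) ≃ Fin (4 * n) :=
  finSumFinEquiv.trans (finCongr (by omega))

/-- The permuted block matrix: top left is `M1`. -/
noncomputable def topR (n : ℕ) (d ζ : Fin (n + n) → ℂ) : Matrix (Fin (n + n)) (Fin (n + n)) ℂ :=
  Matrix.of fun i c => if (c : ℕ) = n - 1 then bvec n d ζ (n - 1) i else 0

noncomputable def botL (n : ℕ) (d ζ : Fin (n + n) → ℂ) : Matrix (Fin (n + n)) (Fin (n + n)) ℂ :=
  Matrix.of fun i c => if (c : ℕ) ≤ 2 then avec n d ζ (n + 1 - c) i else 0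

noncomputable def botR (n : ℕ) (d ζ : Fin (n + n) → ℂ) : Matrix (Fin (n + n)) (Fin (n + n)) ℂ :=
  Matrix.of fun i c => if (c : ℕ) + 2 ≤ n then avec n d ζ (n - 2 - c) i
    else if (c : ℕ) = n - 1 then 0 else bvec n d ζ (2 * n - 1 - c) i

noncomputable def Xmat (n : ℕ) (κ : ℂ) : Matrix (Fin (n + n)) (Fin (n + n)) ℂ :=
  Matrix.of fun r c => if (c : ℕ) ≤ n then (if (r : ℕ) + 3 = c then 1 else 0)
    else (if (r : ℕ) + 1 = c then κ else 0)

lemma M1_apply (n : ℕ) (d ζ : Fin (n + n) → ℂ) (i c : Fin (n + n)) :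
    M1 n d ζ i c = if (c : ℕ) ≤ n then avec n d ζ (n - c) i
      else bvec n d ζ (2 * n - 1 - c) i := rfl

lemma M2_apply (n : ℕ) (d ζ : Fin (n + n) → ℂ) (i c : Fin (n + n)) :
    M2 n d ζ i c = if (c : ℕ) + 2 ≤ n then avec n d ζ (n - 2 - c) i
      else bvec n d ζ (2 * n - 1 - c) i := rfl

lemma topVec_eq (n : ℕ) (d ζ : Fin (n + n) → ℂ) (c : ℕ) :
    topVec n d ζ c = if c ≤ n then avec n d ζ (n - c)
      else if c ≤ 2 * n then bvec n d ζ (2 * n - c) else 0 := rfl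

lemma botVec_eq (n : ℕ) (d ζ : Fin (n + n) → ℂ) (c : ℕ) :
    botVec n d ζ c = if c ≤ 2 then avec n d ζ (n + 1 - c)
      else if c ≤ 2 * n then 0
      else if c ≤ 3 * n - 1 then avec n d ζ (3 * n - 1 - c)
      else bvec n d ζ (4 * n - 1 - c) := rfl

lemma blocks (n : ℕ) (hn : 2 ≤ n) (d ζ : Fin (n + n) → ℂ) :
    ((PiMat n d ζ).submatrix id
      (Fin.cycleIcc (⟨n + 1, by omega⟩ : Fin (4 * n)) ⟨3 * n - 1, by omega⟩)).submatrix
        (splitE n) (splitE n) =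
      Matrix.fromBlocks (M1 n d ζ) (topR n d ζ) (botL n d ζ) (botR n d ζ) := by
  have el : ∀ c, ((splitE n (Sum.inl c) : Fin (4 * n)) : ℕ) = c := fun c => by simp [splitE]
  have er : ∀ c, ((splitE n (Sum.inr c) : Fin (4 * n)) : ℕ) = n + n + c := fun c => by
    simp [splitE, add_comm]
  ext i c
  rcases i with i | i <;> rcases c with c | c <;>
    simp only [Matrix.submatrix_apply, PiMat, Matrix.of_apply, cycle_val n hn, el, er, id_eq,
      Fin.is_lt, dite_true, Fin.eta, Matrix.fromBlocks_apply₁₁, Matrix.fromBlocks_apply₁₂,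
      Matrix.fromBlocks_apply₂₁, Matrix.fromBlocks_apply₂₂]
  · have := c.isLt
    rw [topVec_eq, M1_apply]
    unfold colIdx
    split_ifs <;> first | rfl | omega | (congr 1; omega)
  · have := c.isLt
    rw [topVec_eq, topR, Matrix.of_apply]
    unfold colIdx
    split_ifs <;> first | rfl | omega | (congr 1; omega)
  · have := c.isLt
    have hh : ¬ (n + n + (i : ℕ) < n + n) := by omega
    simp only [hh, dite_false, Nat.add_sub_cancel_left, Fin.eta]
    rw [botVec_eq, botL, Matrix.of_apply]
    unfold colIdx
    split_ifs <;> first | rfl | omega | (congr 1; omega)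
  · have := c.isLt
    have hh : ¬ (n + n + (i : ℕ) < n + n) := by omega
    simp only [hh, dite_false, Nat.add_sub_cancel_left, Fin.eta]
    rw [botVec_eq, botR, Matrix.of_apply]
    unfold colIdx
    split_ifs <;> first | rfl | omega | (congr 1; omega)

lemma mul_Xmat (n : ℕ) (κ : ℂ) (A : Matrix (Fin (n + n)) (Fin (n + n)) ℂ) (i c : Fin (n + n)) :
    (A * Xmat n κ) i c = if (c : ℕ) ≤ n then (if 3 ≤ (c : ℕ) then A i ⟨c - 3, by omega⟩ else 0)
      else A i ⟨c - 1, by omega⟩ * κ := by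
  rw [Matrix.mul_apply]
  split_ifs with h1 h2
  · rw [Finset.sum_eq_single (⟨c - 3, by omega⟩ : Fin (n + n))]
    · simp [Xmat, h1, h2]
    · intro r _ hr
      have : (r : ℕ) + 3 ≠ c := fun h => hr (Fin.ext (by simp; omega))
      simp [Xmat, h1, this]
    · simp
  · apply Finset.sum_eq_zero
    intro r _
    have : (r : ℕ) + 3 ≠ c := by omega
    simp [Xmat, h1, this]
  · rw [Finset.sum_eq_single (⟨c - 1, by omega⟩ : Fin (n + n))]
    · have : (c : ℕ) - 1 + 1 = c := by omega
      simp [Xmat, h1, this]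
    · intro r _ hr
      have : (r : ℕ) + 1 ≠ c := fun h => hr (Fin.ext (by simp; omega))
      simp [Xmat, h1, this]
    · simp

theorem det_Pi_factorization (n : ℕ) (hn : 2 ≤ n)
    (d : Fin (n + n) → ℂ) (ζ : Fin (n + n) → ℂ) (ε : ℂ) (hε : ε = 1 ∨ ε = -1)
    (hd : ∀ j : Fin n,
      (starRingEnd ℂ) (d ⟨n + (j : ℕ), by have := j.isLt; omega⟩) =
        Complex.I * ε * d ⟨(j : ℕ), by have := j.isLt; omega⟩) :
    (PiMat n d ζ).det = Complex.I * ε * (M1 n d ζ).det * (M2 n d ζ).det := by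
  have hd' : ∀ i j : Fin (n + n), (j : ℕ) = n + i →
      (starRingEnd ℂ) (d j) = Complex.I * ε * d i := by
    intro i j hij
    have hi : (i : ℕ) < n := by omega
    have h := hd ⟨i, hi⟩
    have e : j = ⟨n + i, by omega⟩ := Fin.ext hij
    rw [e]
    exact h
  have hb := bvec_succ n d ζ ε hε hd'
  have ha := avec_succ n d ζ
  have h1 : (PiMat n d ζ).det =
      (Matrix.fromBlocks (M1 n d ζ) (topR n d ζ) (botL n d ζ) (botR n d ζ)).det := by
    rw [← blocks n hn, Matrix.det_submatrix_equiv_self, Matrix.det_permute',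
      Fin.sign_cycleIcc_of_le (by rw [Fin.le_def]; simp; omega)]
    have : 3 * n - 1 - (n + 1) = 2 * (n - 1) := by omega
    simp [this, pow_mul]
  set κ : ℂ := -(Complex.I * ε) with hκ
  set D := botR n d ζ - Matrix.diagonal d * topR n d ζ with hD
  have hDM : D = Matrix.of fun (i c : Fin (n + n)) =>
      (if (c : ℕ) = n - 1 then -κ else 1) * M2 n d ζ i c := by
    ext i c
    have := c.isLt
    rw [hD, Matrix.sub_apply, Matrix.diagonal_mul, Matrix.of_apply, M2_apply, topR, botR,
      Matrix.of_apply, Matrix.of_apply]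
    split_ifs with g1 g2 g3
    · omega
    · ring
    · have e1 : 2 * n - 1 - (c : ℕ) = n - 1 + 1 := by omega
      rw [hb, e1]; ring
    · ring
  have hdetD : D.det = -κ * (M2 n d ζ).det := by
    rw [hDM, Matrix.det_mul_row]
    congr 1
    rw [Finset.prod_eq_single (⟨n - 1, by omega⟩ : Fin (n + n))]
    · simp
    · intro c _ hc
      have : (c : ℕ) ≠ n - 1 := fun h => hc (Fin.ext h)
      simp [this]
    · simp
  have hTX : topR n d ζ * Xmat n κ = 0 := by
    ext i c
    have := c.isLt
    rw [mul_Xmat, Matrix.zero_apply]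
    simp only [topR, Matrix.of_apply]
    split_ifs <;> first | rfl | omega | simp
  have hBX : (botL n d ζ - Matrix.diagonal d * M1 n d ζ) + D * Xmat n κ = 0 := by
    ext i c
    have := c.isLt
    rw [hDM, Matrix.add_apply, Matrix.sub_apply, Matrix.diagonal_mul, mul_Xmat, M1_apply,
      Matrix.zero_apply]
    simp only [botL, Matrix.of_apply, M2_apply]
    by_cases g1 : (c : ℕ) ≤ n
    · by_cases g2 : 3 ≤ (c : ℕ)
      · have e1 : ¬ (c : ℕ) ≤ 2 := by omega
        have e2 : ¬ (c : ℕ) - 3 = n - 1 := by omega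
        have e3 : (c : ℕ) - 3 + 2 ≤ n := by omega
        have e4 : n - 2 - ((c : ℕ) - 3) = n - c + 1 := by omega
        simp only [g1, g2, e1, e2, e3, e4, if_true, if_false, ha]
        ring
      · have e1 : (c : ℕ) ≤ 2 := by omega
        have e4 : n + 1 - (c : ℕ) = n - c + 1 := by omega
        simp only [g1, g2, e1, e4, if_true, if_false, ha]
        ring
    · have e1 : ¬ (c : ℕ) ≤ 2 := by omega
      have e2 : ¬ (c : ℕ) - 1 = n - 1 := by omega
      have e3 : ¬ (c : ℕ) - 1 + 2 ≤ n := by omega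
      have e4 : 2 * n - 1 - ((c : ℕ) - 1) = 2 * n - 1 - c + 1 := by omega
      simp only [g1, e1, e2, e3, e4, if_false, hb]
      ring
  have key : Matrix.fromBlocks 1 0 (-Matrix.diagonal d) 1 *
      Matrix.fromBlocks (M1 n d ζ) (topR n d ζ) (botL n d ζ) (botR n d ζ) *
      Matrix.fromBlocks 1 0 (Xmat n κ) 1 = Matrix.fromBlocks (M1 n d ζ) (topR n d ζ) 0 D := by
    rw [Matrix.fromBlocks_multiply, Matrix.fromBlocks_multiply]
    have t : -Matrix.diagonal d * topR n d ζ + botR n d ζ = D := by rw [hD]; noncomm_ring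
    simp only [Matrix.one_mul, Matrix.zero_mul, add_zero, Matrix.mul_one, Matrix.mul_zero, zero_add,
      hTX, t]
    congr 1
    rw [← hBX]; noncomm_ring
  have hdet := congrArg Matrix.det key
  rw [Matrix.det_mul, Matrix.det_mul, Matrix.det_fromBlocks_zero₁₂, Matrix.det_fromBlocks_zero₁₂,
    Matrix.det_fromBlocks_zero₂₁, hdetD] at hdet
  simp only [Matrix.det_one, one_mul, mul_one] at hdet
  rw [h1, hdet, hκ]
  ring
end
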